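/- arXiv:1112.1628 — 2 statements merged into one kernel-verified Lean document; each statement's English description precedes it below -/
import Mathlib

section
/- In the Beckmann route-flow setup, suppose each τ_e : ℝ → ℝ is continuous and strictly increasing. If x* and y* are both minimizers of the Beckmann potential Ψ over X, then Θx* = Θy*, i.e., the equilibrium edge-flow vector is unique even though the route-flow minimizer need not be. -/
open Finset

/-- The feasible route-flow set `X`: nonnegative flows meeting each demand `d w`
on the class of routes `P_w = {p | part p = w}`. -/
def inX {P W : Type*} [Fintype P] [DecidableEq W]
    (part : P → W) (d : W → ℝ) (x : P → ℝ) : Prop :=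
  (∀ p, 0 ≤ x p) ∧ ∀ w, ∑ p ∈ univ.filter (fun p => part p = w), x p = d w

/-- Edge flow `(Θx)_e = Σ_p δ_ep x_p`. -/
def edgeFlow {P E : Type*} [Fintype P] (δ : E → P → ℝ) (x : P → ℝ) (e : E) : ℝ :=
  ∑ p, δ e p * x p

/-- Route cost `G_p(x) = Σ_e δ_ep τ_e((Θx)_e)`. -/
noncomputable def routeCost {P E : Type*} [Fintype P] [Fintype E]
    (δ : E → P → ℝ) (τ : E → ℝ → ℝ) (x : P → ℝ) (p : P) : ℝ :=
  ∑ e, δ e p * τ e (edgeFlow δ x e)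

/-- Beckmann potential `Ψ(x) = Σ_e ∫_0^{(Θx)_e} τ_e(z) dz`. -/
noncomputable def beckmann {P E : Type*} [Fintype P] [Fintype E]
    (δ : E → P → ℝ) (τ : E → ℝ → ℝ) (x : P → ℝ) : ℝ :=
  ∑ e, ∫ z in (0 : ℝ)..(edgeFlow δ x e), τ e z

theorem primitive_strictConvex (f : ℝ → ℝ) (hc : Continuous f) (hm : StrictMono f) :
    StrictConvexOn ℝ Set.univ (fun u : ℝ => ∫ z in (0 : ℝ)..u, f z) := by
  have hd : ∀ u, HasDerivAt (fun u : ℝ => ∫ z in (0 : ℝ)..u, f z) (f u) u := fun u =>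
    intervalIntegral.integral_hasDerivAt_right (hc.intervalIntegrable _ _)
      hc.stronglyMeasurable.stronglyMeasurableAtFilter hc.continuousAt
  apply StrictMono.strictConvexOn_univ_of_deriv
  · exact continuous_iff_continuousAt.2 fun u => (hd u).continuousAt
  · have : deriv (fun u : ℝ => ∫ z in (0 : ℝ)..u, f z) = f := funext fun u => (hd u).deriv
    rw [this]
    exact hm

theorem stmt_15 {P E W : Type*} [Fintype P] [Fintype E] [Fintype W] [DecidableEq W]
    [Nonempty P]
    (part : P → W) (hpart : ∀ w : W, ∃ p, part p = w)
    (d : W → ℝ) (hd : ∀ w, 0 < d w)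
    (δ : E → P → ℝ) (hδ : ∀ e p, δ e p = 0 ∨ δ e p = 1)
    (τ : E → ℝ → ℝ) (hτc : ∀ e, Continuous (τ e)) (hτm : ∀ e, StrictMono (τ e))
    (xs ys : P → ℝ) (hxs : inX part d xs) (hys : inX part d ys)
    (hxsmin : ∀ x, inX part d x → beckmann δ τ xs ≤ beckmann δ τ x)
    (hysmin : ∀ x, inX part d x → beckmann δ τ ys ≤ beckmann δ τ x) :
    edgeFlow δ xs = edgeFlow δ ys := by
  by_contra hne
  obtain ⟨e0, he0⟩ := Function.ne_iff.1 hne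
  let m : P → ℝ := fun p => (1/2) * xs p + (1/2) * ys p
  have hm : inX part d m := by
    refine ⟨fun p => ?_, fun w => ?_⟩
    · have h1 := hxs.1 p
      have h2 := hys.1 p
      simp only [m]
      linarith
    · simp only [m, Finset.sum_add_distrib, ← Finset.mul_sum]
      rw [hxs.2 w, hys.2 w]
      ring
  have hflow : ∀ e, edgeFlow δ m e = (1/2) * edgeFlow δ xs e + (1/2) * edgeFlow δ ys e := by
    intro e
    simp only [edgeFlow, m, Finset.mul_sum, ← Finset.sum_add_distrib]
    exact Finset.sum_congr rfl fun p _ => by ring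
  have hlt : beckmann δ τ m < (1/2) * beckmann δ τ xs + (1/2) * beckmann δ τ ys := by
    simp only [beckmann, Finset.mul_sum, ← Finset.sum_add_distrib]
    apply Finset.sum_lt_sum
    · intro e _
      rw [hflow e]
      exact (primitive_strictConvex (τ e) (hτc e) (hτm e)).convexOn.2 (Set.mem_univ _)
        (Set.mem_univ _) (by norm_num) (by norm_num) (by norm_num)
    · refine ⟨e0, Finset.mem_univ _, ?_⟩
      rw [hflow e0]
      exact (primitive_strictConvex (τ e0) (hτc e0) (hτm e0)).2 (Set.mem_univ _)
        (Set.mem_univ _) he0 (by norm_num) (by norm_num) (by norm_num)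
  have h1 := hxsmin m hm
  have h2 := hysmin m hm
  linarith
end

section
/- In the Beckmann route-flow setup, suppose each τ_e : ℝ → ℝ is continuous and nondecreasing, each class P_w is nonempty, and each demand satisfies d_w ≥ 0. Then there exists a Nash–Wardrop equilibrium: a point x* ∈ X such that for every w ∈ W and every p ∈ P_w, x*_p · ( G_p(x*) − min_{q∈P_w} G_q(x*) ) = 0. -/
open Finset

lemma edgeFlow_line {P E : Type*} [Fintype P] (δ : E → P → ℝ) (x v : P → ℝ) (t : ℝ) (e : E) :
    edgeFlow δ (x + t • v) e = edgeFlow δ x e + t * edgeFlow δ v e := by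
  simp only [edgeFlow, Pi.add_apply, Pi.smul_apply, smul_eq_mul, mul_add, sum_add_distrib, mul_sum]
  congr 1
  exact sum_congr rfl fun p _ => by ring

lemma beckmann_continuous {P E : Type*} [Fintype P] [Fintype E]
    (δ : E → P → ℝ) (τ : E → ℝ → ℝ) (hτc : ∀ e, Continuous (τ e)) :
    Continuous (beckmann δ τ) := by
  unfold beckmann
  refine continuous_finset_sum _ fun e _ => ?_
  have h1 : Continuous (fun u : ℝ => ∫ z in (0 : ℝ)..u, τ e z) :=
    intervalIntegral.continuous_primitive (fun a b => (hτc e).intervalIntegrable a b) 0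
  have h2 : Continuous (fun x : P → ℝ => edgeFlow δ x e) := by
    unfold edgeFlow; fun_prop
  exact h1.comp h2

lemma beckmann_deriv {P E : Type*} [Fintype P] [Fintype E]
    (δ : E → P → ℝ) (τ : E → ℝ → ℝ) (hτc : ∀ e, Continuous (τ e)) (x v : P → ℝ) :
    HasDerivAt (fun t : ℝ => beckmann δ τ (x + t • v))
      (∑ e, τ e (edgeFlow δ x e) * edgeFlow δ v e) 0 := by
  unfold beckmann
  refine HasDerivAt.fun_sum fun e _ => ?_
  simp only [edgeFlow_line]
  have h1 : HasDerivAt (fun u : ℝ => ∫ z in (0 : ℝ)..u, τ e z) (τ e (edgeFlow δ x e))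
      (edgeFlow δ x e + 0 * edgeFlow δ v e) := by
    have := ((hτc e).integral_hasStrictDerivAt 0 (edgeFlow δ x e)).hasDerivAt
    simpa using this
  have h2 : HasDerivAt (fun t : ℝ => edgeFlow δ x e + t * edgeFlow δ v e) (edgeFlow δ v e) 0 := by
    simpa using ((hasDerivAt_id (0 : ℝ)).mul_const (edgeFlow δ v e)).const_add (edgeFlow δ x e)
  exact h1.comp 0 h2

lemma deriv_nonneg_of_right_min (g : ℝ → ℝ) (g' a : ℝ) (ha : 0 < a) (hg : HasDerivAt g g' 0)
    (hm : ∀ t, 0 < t → t < a → g 0 ≤ g t) : 0 ≤ g' := by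
  have h := (hasDerivWithinAt_iff_tendsto_slope' (s := Set.Ioi (0 : ℝ)) (by simp)).1
    hg.hasDerivWithinAt
  refine ge_of_tendsto h ?_
  filter_upwards [Ioo_mem_nhdsGT ha] with t ht
  rw [slope_def_field]
  have := hm t ht.1 ht.2
  exact div_nonneg (by linarith) (by linarith [ht.1])

lemma inX_compact {P W : Type*} [Fintype P] [DecidableEq W] (part : P → W) (d : W → ℝ) :
    IsCompact {x | inX part d x} := by
  refine (isCompact_Icc (a := (0 : P → ℝ)) (b := fun p => d (part p))).of_isClosed_subset ?_ ?_
  · simp only [inX, Set.setOf_and, Set.setOf_forall]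
    refine IsClosed.inter (isClosed_iInter fun p => ?_) (isClosed_iInter fun w => ?_)
    · exact isClosed_le continuous_const (continuous_apply p)
    · exact isClosed_eq (by fun_prop) continuous_const
  · rintro x ⟨h0, hs⟩
    refine ⟨fun p => h0 p, fun p => ?_⟩
    show x p ≤ d (part p)
    rw [← hs (part p)]
    exact single_le_sum (f := x) (fun q _ => h0 q) (by simp)

lemma inX_nonempty {P W : Type*} [Fintype P] [DecidableEq W] (part : P → W)
    (hne : ∀ w : W, (univ.filter (fun p => part p = w)).Nonempty)
    (d : W → ℝ) (hd : ∀ w, 0 ≤ d w) : ∃ x, inX part d x := by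
  classical
  choose c hc using hne
  refine ⟨fun p => if p = c (part p) then d (part p) else 0, fun p => ?_, fun w => ?_⟩
  · dsimp only
    split_ifs
    · exact hd _
    · exact le_rfl
  · have : ∀ p ∈ univ.filter (fun p => part p = w),
        (if p = c (part p) then d (part p) else 0) = if p = c w then d w else 0 := by
      intro p hp
      rw [(mem_filter.1 hp).2]
    rw [sum_congr rfl this, sum_ite_eq' _ (c w), if_pos (hc w)]

theorem stmt_19 {P E W : Type*} [Fintype P] [Fintype E] [Fintype W] [DecidableEq W]
    [Nonempty P]
    (part : P → W)
    (hne : ∀ w : W, (univ.filter (fun p => part p = w)).Nonempty)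
    (d : W → ℝ) (hd : ∀ w, 0 ≤ d w)
    (δ : E → P → ℝ) (hδ : ∀ e p, δ e p = 0 ∨ δ e p = 1)
    (τ : E → ℝ → ℝ) (hτc : ∀ e, Continuous (τ e)) (hτm : ∀ e, Monotone (τ e)) :
    ∃ xs : P → ℝ, inX part d xs ∧
      ∀ w : W, ∀ p, part p = w →
        xs p * (routeCost δ τ xs p -
          (univ.filter (fun q => part q = w)).inf' (hne w) (routeCost δ τ xs)) = 0 := by
  classical
  obtain ⟨x, hx, hmin⟩ := (inX_compact part d).exists_isMinOn (inX_nonempty part hne d hd)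
    (beckmann_continuous δ τ hτc).continuousOn
  refine ⟨x, hx, ?_⟩
  intro w p hp
  rcases (hx.1 p).eq_or_lt with h0 | hpos
  · rw [← h0, zero_mul]
  have key : ∀ q, part q = w → routeCost δ τ x p ≤ routeCost δ τ x q := by
    intro q hq
    by_cases hpq : p = q
    · rw [hpq]
    set v : P → ℝ := Pi.single q 1 - Pi.single p 1 with hv
    have hder := beckmann_deriv δ τ hτc x v
    have hedge : ∀ e, edgeFlow δ v e = δ e q - δ e p := by
      intro e
      simp [edgeFlow, hv, mul_sub, Pi.single_apply]
    have hval : (∑ e, τ e (edgeFlow δ x e) * edgeFlow δ v e)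
        = routeCost δ τ x q - routeCost δ τ x p := by
      simp only [hedge, routeCost, ← sum_sub_distrib]
      exact sum_congr rfl fun e _ => by ring
    rw [hval] at hder
    have := deriv_nonneg_of_right_min _ _ (x p) hpos hder (by
      intro t ht0 hta
      have hmem : inX part d (x + t • v) := by
        constructor
        · intro r
          have hr := hx.1 r
          by_cases h1 : r = p
          · subst h1
            simp [hv, Pi.single_apply, hpq]
            linarith
          · by_cases h2 : r = q
            · subst h2
              simp [hv, Pi.single_apply, h1]
              linarith
            · simpa [hv, Pi.single_apply, h1, h2] using hr
        · intro w'
          have hs := hx.2 w'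
          simp only [Pi.add_apply, Pi.smul_apply, smul_eq_mul, sum_add_distrib, ← mul_sum, hs]
          simp [hv, Pi.single_apply, hp, hq]
      simpa using hmin hmem)
    linarith
  have hinf : (univ.filter (fun q => part q = w)).inf' (hne w) (routeCost δ τ x)
      = routeCost δ τ x p := by
    refine le_antisymm (inf'_le _ (by simp [hp])) (le_inf' _ _ fun q hq => ?_)
    exact key q (mem_filter.1 hq).2
  rw [hinf, sub_self, mul_zero]
end
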